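/- Let T > 0 and let f : [0,T] → ℝ^d be càdlàg. For each n ∈ ℕ let 0 = t_0^n < t_1^n < ⋯ < t_{k_n}^n = T be the partition defined recursively by t_{i+1}^n := min( inf{ t ∈ (t_i^n, T] : ‖f(t) − f(t⁻)‖ ≥ 2^{-n} }, t_i^n + 2^{-n}, T ), and define the piecewise-constant approximation f_n(t) := f(t_i^n) for t ∈ [t_i^n, t_{i+1}^n) (i < k_n) and f_n(T) := f(T). Then for every t ∈ [0,T] at which f is left-continuous (i.e., t = 0 or f(t⁻) = f(t)), f_n(t) → f(t) as n → ∞. In particular f_n(t) → f(t) for all t outside a countable set. -/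

import Mathlib

open Filter Set Function Classical

noncomputable section

/-- A path `f : ℝ → ℝ^d` is càdlàg on `[0,T]`: right-continuous at every `t ∈ [0,T)`
and with a left limit at every `t ∈ (0,T]`. -/
def Cadlag (d : ℕ) (T : ℝ) (f : ℝ → EuclideanSpace ℝ (Fin d)) : Prop :=
  (∀ t ∈ Set.Ico (0 : ℝ) T, ContinuousWithinAt f (Set.Ici t) t) ∧
  (∀ t ∈ Set.Ioc (0 : ℝ) T, ∃ L, Filter.Tendsto f (nhdsWithin t (Set.Iio t)) (nhds L))

/-- Let `f` be càdlàg on `[0,T]` and, for each `n`, let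
`0 = t^n_0 < t^n_1 < ⋯ < t^n_{k_n} = T` be the partition defined recursively by
`t^n_{i+1} = min( inf{ s ∈ (t^n_i, T] : ‖f(s) - f(s⁻)‖ ≥ 2^{-n} }, t^n_i + 2^{-n}, T )`
(with `inf ∅ = +∞`), and let `fN n` be the piecewise-constant approximation with
`fN n s = f (t^n_i)` on `[t^n_i, t^n_{i+1})` and `fN n T = f T`. Then `fN n s → f s`
at every `s ∈ [0,T]` at which `f` is left-continuous (i.e. `s = 0` or `f(s⁻) = f(s)`);
in particular the convergence holds outside a countable set. -/
theorem cadlag_piecewise_approx_tendsto (d : ℕ) (T : ℝ) (hT : 0 < T)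
    (f : ℝ → EuclideanSpace ℝ (Fin d)) (hf : Cadlag d T f)
    (t : ℕ → ℕ → ℝ) (k : ℕ → ℕ)
    (ht0 : ∀ n, t n 0 = 0)
    (hrec : ∀ n i,
      t n (i + 1) =
        if {s ∈ Set.Ioc (t n i) T | (2 : ℝ) ^ (-(n : ℤ)) ≤ ‖f s - Function.leftLim f s‖} = ∅
        then min (t n i + (2 : ℝ) ^ (-(n : ℤ))) T
        else min (min
          (sInf {s ∈ Set.Ioc (t n i) T |
            (2 : ℝ) ^ (-(n : ℤ)) ≤ ‖f s - Function.leftLim f s‖})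
          (t n i + (2 : ℝ) ^ (-(n : ℤ)))) T)
    (hkT : ∀ n, t n (k n) = T)
    (hklt : ∀ n, ∀ i < k n, t n i < T)
    (fN : ℕ → ℝ → EuclideanSpace ℝ (Fin d))
    (hfN : ∀ n, ∀ i < k n, ∀ s ∈ Set.Ico (t n i) (t n (i + 1)), fN n s = f (t n i))
    (hfNT : ∀ n, fN n T = f T) :
    (∀ s ∈ Set.Icc (0 : ℝ) T, (s = 0 ∨ Function.leftLim f s = f s) →
      Filter.Tendsto (fun n => fN n s) Filter.atTop (nhds (f s))) ∧
    ∃ C : Set ℝ, C.Countable ∧ ∀ s ∈ Set.Icc (0 : ℝ) T, s ∉ C →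
      Filter.Tendsto (fun n => fN n s) Filter.atTop (nhds (f s)) := by
  have hle : ∀ n i, t n (i + 1) ≤ t n i + (2 : ℝ) ^ (-(n : ℤ)) := by
    intro n i
    rw [hrec]
    split_ifs
    · exact min_le_left _ _
    · exact (min_le_left _ _).trans (min_le_right _ _)
  have hnn : ∀ n i, 0 ≤ t n i := by
    intro n i
    induction i with
    | zero => rw [ht0]
    | succ i ih =>
      have h2 : (0 : ℝ) < (2 : ℝ) ^ (-(n : ℤ)) := by positivity
      rw [hrec]
      split_ifs
      · exact le_min (by linarith) hT.le
      · refine le_min (le_min ?_ (by linarith)) hT.le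
        exact Real.sInf_nonneg fun x hx => ih.trans hx.1.1.le
  have main : ∀ s ∈ Set.Icc (0 : ℝ) T, (s = 0 ∨ Function.leftLim f s = f s) →
      Filter.Tendsto (fun n => fN n s) Filter.atTop (nhds (f s)) := by
    intro s hs hcont
    rcases hs.2.eq_or_lt with rfl | hsT
    · simp only [hfNT]
      exact tendsto_const_nhds
    have hp : ∀ n : ℕ, ∃ p, 0 ≤ p ∧ p ≤ s ∧ s - (2 : ℝ) ^ (-(n : ℤ)) ≤ p ∧ fN n s = f p := by
      intro n
      have hex : ∃ j, s < t n j := ⟨k n, by rw [hkT]; exact hsT⟩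
      have hj := Nat.find_spec hex
      have hjk : Nat.find hex ≤ k n := Nat.find_min' hex (by rw [hkT]; exact hsT)
      have hmin := fun m => @Nat.find_min _ _ hex m
      generalize Nat.find hex = j at hj hjk hmin
      cases j with
      | zero => rw [ht0] at hj; exact absurd hs.1 (not_le.2 hj)
      | succ i =>
        have hi : t n i ≤ s := not_lt.1 (hmin i (Nat.lt_succ_self i))
        exact ⟨t n i, hnn n i, hi, by linarith [hle n i], hfN n i hjk s ⟨hi, hj⟩⟩
    choose p hp0 hps hpl hpf using hp
    simp only [hpf]
    rcases hs.1.eq_or_lt with h0 | h0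
    · have : ∀ n, p n = s := fun n => le_antisymm (hps n) (h0 ▸ hp0 n)
      simp only [this]
      exact tendsto_const_nhds
    have hl : Function.leftLim f s = f s := hcont.resolve_left h0.ne'
    obtain ⟨L, hL⟩ := hf.2 s ⟨h0, hs.2⟩
    have hL' : Function.leftLim f s = L := leftLim_eq_of_tendsto (h := inferInstance) hL
    have hc : ContinuousWithinAt f (Set.Iic s) s := by
      rw [← continuousWithinAt_Iio_iff_Iic]
      rw [← hL', hl] at hL
      exact hL
    have hpow : Filter.Tendsto (fun n : ℕ => (2 : ℝ) ^ (-(n : ℤ))) Filter.atTop (nhds 0) := by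
      have := tendsto_pow_atTop_nhds_zero_of_lt_one (r := (1 / 2 : ℝ)) (by norm_num) (by norm_num)
      refine this.congr fun n => ?_
      simp
    have hpt : Filter.Tendsto p Filter.atTop (nhds s) := by
      refine tendsto_of_tendsto_of_tendsto_of_le_of_le ?_ tendsto_const_nhds hpl hps
      simpa using hpow.const_sub s
    exact hc.tendsto.comp (tendsto_nhdsWithin_iff.2 ⟨hpt, Filter.Eventually.of_forall hps⟩)
  refine ⟨main, Set.range (fun q : ℕ × ℕ => t q.1 q.2), Set.countable_range _, ?_⟩
  intro s hs hsC
  refine main s hs (Or.inr ?_)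
  by_contra hne
  have hpos : 0 < ‖f s - Function.leftLim f s‖ := norm_pos_iff.2 (sub_ne_zero.2 (Ne.symm hne))
  obtain ⟨n, hn⟩ := exists_pow_lt_of_lt_one hpos (by norm_num : (1 / 2 : ℝ) < 1)
  have hn' : (2 : ℝ) ^ (-(n : ℤ)) ≤ ‖f s - Function.leftLim f s‖ := by
    refine le_trans (le_of_eq ?_) hn.le
    simp
  have hex : ∃ j, s ≤ t n j := ⟨k n, by rw [hkT]; exact hs.2⟩
  have hj := Nat.find_spec hex
  have hmin := fun m => @Nat.find_min _ _ hex m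
  generalize Nat.find hex = j at hj hmin
  cases j with
  | zero => exact hsC ⟨(n, 0), le_antisymm (by simpa [ht0] using hs.1) hj⟩
  | succ i =>
    have hi : t n i < s := not_le.1 (hmin i (Nat.lt_succ_self i))
    have hmem : s ∈ {s ∈ Set.Ioc (t n i) T |
        (2 : ℝ) ^ (-(n : ℤ)) ≤ ‖f s - Function.leftLim f s‖} := ⟨⟨hi, hs.2⟩, hn'⟩
    refine hsC ⟨(n, i + 1), le_antisymm ?_ hj⟩
    show t n (i + 1) ≤ s
    rw [hrec, if_neg (Set.Nonempty.ne_empty ⟨s, hmem⟩)]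
    refine (min_le_left _ _).trans ((min_le_left _ _).trans (csInf_le ⟨t n i, ?_⟩ hmem))
    exact fun x hx => hx.1.1.le
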